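/- arXiv:2401.00527 — 7 statements merged into one kernel-verified Lean document; each statement's English description precedes it below -/
import Mathlib

section
/- Let (Ω, μ) be a probability space, let N : Ω → ℕ be a measurable random variable, and let δ > 0 and B ∈ ℝ be constants such that μ({ω : (N(ω))² ≥ t}) ≤ exp(B·t − δ·t·log t) for every real t ≥ 1. Then there exists a constant c > 0 such that for every λ > 0, the exponential moment satisfies ∫_Ω exp(λ·(N(ω))²) dμ(ω) ≤ exp(c·(exp(λ/δ) − 1)). -/
open MeasureTheory

lemma key_bound (δ B lam n : ℝ) (hδ : 0 < δ) (hl : 0 < lam) (hn : 1 ≤ n) :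
    (Real.exp (lam * n) - 1) * Real.exp (B * n - δ * n * Real.log n) ≤
      δ * (Real.exp (lam / δ) - 1) *
        Real.exp (δ * Real.exp ((B + 2) / δ) * Real.exp (lam / δ)) * Real.exp (-n) := by
  have hn0 : 0 < n := by linarith
  have h1 : Real.exp (lam * n) - 1 ≤ lam * n * Real.exp (lam * n) := by
    have h := Real.add_one_le_exp (-(lam * n))
    have h2 : Real.exp (-(lam * n)) * Real.exp (lam * n) = 1 := by
      rw [← Real.exp_add]; simp
    nlinarith [Real.exp_pos (lam * n)]
  have h2 : lam ≤ δ * (Real.exp (lam / δ) - 1) := by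
    have h := Real.add_one_le_exp (lam / δ)
    have h3 : lam = δ * (lam / δ) := by field_simp
    nlinarith
  have h3 : n ≤ Real.exp n := by linarith [Real.add_one_le_exp n]
  have h4 : lam * n + n + (B * n - δ * n * Real.log n) ≤
      δ * Real.exp ((B + 2) / δ) * Real.exp (lam / δ) + -n := by
    have h := Real.add_one_le_exp ((B + 2) / δ + lam / δ - Real.log n)
    rw [Real.exp_sub, Real.exp_log hn0, Real.exp_add, le_div_iff₀ hn0] at h
    have h5 := mul_le_mul_of_nonneg_left h hδ.le
    have h6 : δ * (((B + 2) / δ + lam / δ - Real.log n + 1) * n) =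
      (B + 2) * n + lam * n - δ * n * Real.log n + δ * n := by field_simp
    have : 0 < δ * n := by positivity
    nlinarith
  calc _ ≤ (lam * n * Real.exp (lam * n)) * Real.exp (B * n - δ * n * Real.log n) := by gcongr
    _ ≤ (δ * (Real.exp (lam / δ) - 1) * Real.exp n * Real.exp (lam * n)) *
          Real.exp (B * n - δ * n * Real.log n) := by gcongr; linarith
    _ = δ * (Real.exp (lam / δ) - 1) *
          Real.exp (lam * n + n + (B * n - δ * n * Real.log n)) := by
        rw [Real.exp_add, Real.exp_add]; ring
    _ ≤ δ * (Real.exp (lam / δ) - 1) *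
          Real.exp (δ * Real.exp ((B + 2) / δ) * Real.exp (lam / δ) + -n) := by
        have : 0 ≤ δ * (Real.exp (lam / δ) - 1) := by linarith
        gcongr
    _ = _ := by rw [Real.exp_add]; ring

theorem stmt2 {Ω : Type*} [MeasurableSpace Ω] (μ : Measure Ω) [IsProbabilityMeasure μ]
    (N : Ω → ℕ) (hN : Measurable N) (δ B : ℝ) (hδ : 0 < δ)
    (htail : ∀ t : ℝ, 1 ≤ t →
      μ {ω | t ≤ ((N ω : ℝ)) ^ 2} ≤ ENNReal.ofReal (Real.exp (B * t - δ * t * Real.log t))) :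
    ∃ c > 0, ∀ lam : ℝ, 0 < lam →
      ∫⁻ ω, ENNReal.ofReal (Real.exp (lam * ((N ω : ℝ)) ^ 2)) ∂μ ≤
        ENNReal.ofReal (Real.exp (c * (Real.exp (lam / δ) - 1))) := by
  set M := δ * Real.exp ((B + 2) / δ) with hM
  have hM0 : 0 < M := by positivity
  refine ⟨2 * δ * Real.exp M + M, by positivity, fun lam hl => ?_⟩
  set y := Real.exp (lam / δ) with hy
  have hy1 : 0 < y - 1 := by
    have := Real.add_one_lt_exp (x := lam / δ) (by positivity)
    have : 0 < lam / δ := by positivity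
    linarith
  set a := δ * (y - 1) * Real.exp (M * y) with ha
  have ha0 : 0 < a := by positivity
  have hp : IsProbabilityMeasure (μ.map N) := Measure.isProbabilityMeasure_map hN.aemeasurable
  have e1 : ∫⁻ ω, ENNReal.ofReal (Real.exp (lam * ((N ω : ℝ)) ^ 2)) ∂μ =
      ∑' k : ℕ, ENNReal.ofReal (Real.exp (lam * (k : ℝ) ^ 2)) * (μ.map N) {k} := by
    rw [← lintegral_countable',
      lintegral_map (f := fun k : ℕ => ENNReal.ofReal (Real.exp (lam * (k : ℝ) ^ 2)))
        (measurable_of_countable _) hN]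
  have e2 : ∑' k : ℕ, (μ.map N) {k} = 1 := by
    have := lintegral_countable' (μ := μ.map N) (fun _ => 1)
    simpa using this.symm
  have e3 : ∑' k : ℕ, ENNReal.ofReal (a * (1 / 2) ^ k) = ENNReal.ofReal (2 * a) := by
    rw [← ENNReal.ofReal_tsum_of_nonneg (fun k => by positivity)
      (summable_geometric_two.mul_left a), tsum_mul_left, tsum_geometric_two, mul_comm]
  have hk : ∀ k : ℕ, ENNReal.ofReal (Real.exp (lam * (k : ℝ) ^ 2)) * (μ.map N) {k} ≤
      (μ.map N) {k} + ENNReal.ofReal (a * (1 / 2) ^ k) := by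
    intro k
    rcases Nat.eq_zero_or_pos k with rfl | hk
    · simp
    have hk1 : (1 : ℝ) ≤ k := by exact_mod_cast hk
    have hk2 : (1 : ℝ) ≤ (k : ℝ) ^ 2 := by nlinarith
    have hm : (μ.map N) {k} ≤ ENNReal.ofReal
        (Real.exp (B * (k : ℝ) ^ 2 - δ * (k : ℝ) ^ 2 * Real.log ((k : ℝ) ^ 2))) := by
      rw [Measure.map_apply hN (measurableSet_singleton k)]
      refine le_trans (measure_mono ?_) (htail _ hk2)
      intro ω hω
      have : N ω = k := hω
      simp [this]
    have hE : 0 ≤ Real.exp (lam * (k : ℝ) ^ 2) - 1 := by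
      have : 0 ≤ lam * (k : ℝ) ^ 2 := by positivity
      linarith [Real.one_le_exp this]
    have hs : ENNReal.ofReal (Real.exp (lam * (k : ℝ) ^ 2)) =
        1 + ENNReal.ofReal (Real.exp (lam * (k : ℝ) ^ 2) - 1) := by
      rw [← ENNReal.ofReal_one, ← ENNReal.ofReal_add zero_le_one hE]; congr 1; ring
    rw [hs, add_mul, one_mul]
    gcongr
    refine (mul_le_mul_right hm _).trans ?_
    rw [← ENNReal.ofReal_mul hE]
    apply ENNReal.ofReal_le_ofReal
    refine (key_bound δ B lam _ hδ hl hk2).trans ?_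
    have hexp : Real.exp (-(k : ℝ) ^ 2) ≤ (1 / 2) ^ k := by
      have h1 : Real.exp (-1) ≤ 1 / 2 := by
        rw [Real.exp_neg, one_div]
        apply inv_anti₀ (by norm_num)
        linarith [Real.add_one_le_exp 1]
      calc Real.exp (-(k : ℝ) ^ 2) ≤ Real.exp (k * (-1)) := by
            apply Real.exp_le_exp.2; nlinarith
        _ = Real.exp (-1) ^ k := Real.exp_nat_mul _ _
        _ ≤ _ := by gcongr
    exact mul_le_mul_of_nonneg_left hexp ha0.le
  rw [e1]
  refine (ENNReal.tsum_le_tsum hk).trans ?_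
  rw [ENNReal.tsum_add, e2, e3, ← ENNReal.ofReal_one, ← ENNReal.ofReal_add zero_le_one (by positivity)]
  apply ENNReal.ofReal_le_ofReal
  have f1 : Real.exp (M * y) = Real.exp M * Real.exp (M * (y - 1)) := by
    rw [← Real.exp_add]; congr 1; ring
  have f2 : 1 ≤ Real.exp (M * (y - 1)) := Real.one_le_exp (by positivity)
  have f3 := Real.add_one_le_exp (2 * δ * Real.exp M * (y - 1))
  rw [add_mul, Real.exp_add, ha, f1]
  calc _ ≤ (2 * δ * Real.exp M * (y - 1) + 1) * Real.exp (M * (y - 1)) := by linarith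
    _ ≤ _ := by gcongr
end

section
/- Let I = [a,b] ⊂ ℝ be a compact interval and let Π : ℝ × ℝ → ℝ be infinitely differentiable. For l ≥ 0 set m_l(Π,I) = (1/l!)·max_{x,y ∈ I} |∂^l Π(x,y)/∂y^l|. Then for every n ≥ 1, |∫_{Iⁿ} det(Π(x_i,x_j))_{i,j=1,…,n} dx₁⋯dxₙ| ≤ (b−a)^{n(n+1)/2} · n! · ∏_{l=0}^{n−1} m_l(Π,I). -/
open MeasureTheory

namespace DetBound

/-- Generalized Rolle, ordered nodes. -/
theorem rolle_fin (a b : ℝ) (l : ℕ) : ∀ (g : ℝ → ℝ), ContDiff ℝ (⊤ : ℕ∞) g →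
    ∀ z : Fin (l + 1) → ℝ, StrictMono z → (∀ i, z i ∈ Set.Icc a b) → (∀ i, g (z i) = 0) →
    ∃ ξ ∈ Set.Icc a b, iteratedDeriv l g ξ = 0 := by
  induction l with
  | zero =>
    intro g _ z _ hz h0
    exact ⟨z 0, hz 0, by simpa using h0 0⟩
  | succ l ih =>
    intro g hg z hmono hz h0
    have key : ∀ i : Fin (l + 1), ∃ w ∈ Set.Ioo (z i.castSucc) (z i.succ), deriv g w = 0 := by
      intro i
      exact exists_deriv_eq_zero (hmono i.castSucc_lt_succ) hg.continuous.continuousOn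
        (by rw [h0, h0])
    choose w hw hw0 using key
    have hg' : ContDiff ℝ (⊤ : ℕ∞) (deriv g) := by
      have := (contDiff_infty_iff_deriv (𝕜 := ℝ) (f := g)).1 hg
      exact this.2
    have hwm : StrictMono w := by
      rw [Fin.strictMono_iff_lt_succ]
      intro i
      have h1 := (hw i.castSucc).2
      have h2 := (hw i.succ).1
      rw [Fin.succ_castSucc] at h1
      exact h1.trans h2
    obtain ⟨ξ, hξ, h⟩ := ih (deriv g) hg' w hwm
      (fun i => ⟨(hz _).1.trans (hw i).1.le, (hw i).2.le.trans (hz _).2⟩) hw0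
    exact ⟨ξ, hξ, by rw [iteratedDeriv_succ']; exact h⟩

theorem rolle_nodes (a b : ℝ) (l : ℕ) (g : ℝ → ℝ) (hg : ContDiff ℝ (⊤ : ℕ∞) g)
    (x : ℕ → ℝ) (hinj : Set.InjOn x (Set.Iio (l + 1))) (hx : ∀ i < l + 1, x i ∈ Set.Icc a b)
    (h0 : ∀ i < l + 1, g (x i) = 0) :
    ∃ ξ ∈ Set.Icc a b, iteratedDeriv l g ξ = 0 := by
  classical
  let s : Finset ℝ := (Finset.range (l + 1)).image x
  have hs : s.card = l + 1 := by
    rw [Finset.card_image_of_injOn, Finset.card_range]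
    intro i hi j hj h
    exact hinj (by simpa using hi) (by simpa using hj) h
  have hmem : ∀ i, ∃ k < l + 1, x k = s.orderEmbOfFin hs i := by
    intro i
    have := s.orderEmbOfFin_mem hs i
    simpa only [s, Finset.mem_image, Finset.mem_range] using this
  refine rolle_fin a b l g hg (s.orderEmbOfFin hs) (s.orderEmbOfFin hs).strictMono ?_ ?_
  · intro i
    obtain ⟨k, hk, h⟩ := hmem i
    rw [← h]; exact hx k hk
  · intro i
    obtain ⟨k, hk, h⟩ := hmem i
    rw [← h]; exact h0 k hk

/-- Newton divided differences. -/
noncomputable def newton (f : ℝ → ℝ) (x : ℕ → ℝ) (l : ℕ) : ℝ :=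
  (f (x l) - ∑ m : Fin l, newton f x m * ∏ k ∈ Finset.range m, (x l - x k)) /
    ∏ k ∈ Finset.range l, (x l - x k)
termination_by l
decreasing_by exact m.2

theorem newton_interp (f : ℝ → ℝ) (x : ℕ → ℝ) (n : ℕ) (hinj : Set.InjOn x (Set.Iio n))
    (N j : ℕ) (hj : j < n) (hN : j < N) :
    ∑ m ∈ Finset.range N, newton f x m * ∏ k ∈ Finset.range m, (x j - x k) = f (x j) := by
  have h1 : ∑ m ∈ Finset.range N, newton f x m * ∏ k ∈ Finset.range m, (x j - x k) =
      ∑ m ∈ Finset.range (j + 1), newton f x m * ∏ k ∈ Finset.range m, (x j - x k) := by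
    symm
    apply Finset.sum_subset
    · intro i hi
      simp only [Finset.mem_range] at *
      omega
    · intro i _ hi
      simp only [Finset.mem_range] at *
      rw [Finset.prod_eq_zero (i := j) (by simp; omega) (by simp), mul_zero]
  have hne : ∏ k ∈ Finset.range j, (x j - x k) ≠ 0 := by
    rw [Finset.prod_ne_zero_iff]
    intro k hk
    have hk' := Finset.mem_range.1 hk
    intro h
    have := hinj (show j ∈ Set.Iio n from hj) (show k ∈ Set.Iio n from hk'.trans hj)
      (sub_eq_zero.1 h)
    omega
  rw [h1, Finset.sum_range_succ, newton.eq_1 f x j, div_mul_cancel₀ _ hne,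
    Finset.sum_range (n := j)]
  ring

open Polynomial in
theorem iteratedDeriv_poly (p : ℝ[X]) (l : ℕ) :
    iteratedDeriv l (fun t => p.eval t) = fun t => (derivative^[l] p).eval t := by
  induction l with
  | zero => simp
  | succ l ih =>
    rw [iteratedDeriv_succ, ih, Function.iterate_succ_apply']
    funext t
    simp

open Polynomial in
theorem newton_mvt (a b : ℝ) (f : ℝ → ℝ) (hf : ContDiff ℝ (⊤ : ℕ∞) f) (x : ℕ → ℝ) (n : ℕ)
    (hinj : Set.InjOn x (Set.Iio n)) (hx : ∀ i < n, x i ∈ Set.Icc a b) (l : ℕ) (hl : l < n) :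
    ∃ ξ ∈ Set.Icc a b, newton f x l = (Nat.factorial l : ℝ)⁻¹ * iteratedDeriv l f ξ := by
  let q : ℕ → ℝ[X] := fun m => ∏ k ∈ Finset.range m, (X - C (x k))
  have hqm : ∀ m, (q m).Monic := fun m => monic_prod_of_monic _ _ fun k _ => monic_X_sub_C _
  have hqd : ∀ m, (q m).natDegree = m := by
    intro m
    simp [q, natDegree_prod_of_monic _ _ fun k _ => monic_X_sub_C (x k)]
  let p : ℝ[X] := ∑ m ∈ Finset.range (l + 1), C (newton f x m) * q m
  have hpe : ∀ t, p.eval t = ∑ m ∈ Finset.range (l + 1),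
      newton f x m * ∏ k ∈ Finset.range m, (t - x k) := by
    intro t
    simp [p, q, eval_finsetSum, eval_prod]
  have hpd : p.natDegree ≤ l := by
    apply natDegree_sum_le_of_forall_le
    intro m hm
    refine (natDegree_C_mul_le _ _).trans ?_
    rw [hqd]
    have := Finset.mem_range.1 hm
    omega
  have hpc : p.coeff l = newton f x l := by
    simp only [p, finsetSum_coeff, coeff_C_mul]
    rw [Finset.sum_range_succ, Finset.sum_eq_zero, zero_add]
    · have := (hqm l).coeff_natDegree
      rw [hqd] at this
      rw [this, mul_one]
    · intro m hm
      rw [coeff_eq_zero_of_natDegree_lt, mul_zero]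
      rw [hqd]; exact Finset.mem_range.1 hm
  have hder : derivative^[l] p = C ((Nat.factorial l : ℝ) * newton f x l) := by
    ext k
    rw [coeff_iterate_derivative, coeff_C]
    split_ifs with hk
    · subst hk
      simp [hpc, Nat.descFactorial_self]
    · rw [coeff_eq_zero_of_natDegree_lt (by omega), smul_zero]
  have hpsm : ContDiff ℝ (⊤ : ℕ∞) (fun t => p.eval t) := by
    have h := p.contDiff_aeval (𝕜 := ℝ) (⊤ : ℕ∞)
    simpa [Polynomial.coe_aeval_eq_eval] using h
  obtain ⟨ξ, hξ, h⟩ := rolle_nodes a b l (f - fun t => p.eval t) (hf.sub hpsm) x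
    (hinj.mono fun i hi => by simp only [Set.mem_Iio] at *; omega)
    (fun i hi => hx i (by omega)) (fun i hi => by
      rw [Pi.sub_apply, hpe, newton_interp f x n hinj _ _ (by omega) hi, sub_self])
  refine ⟨ξ, hξ, ?_⟩
  rw [iteratedDeriv_sub (hf.of_le (by exact_mod_cast le_top)).contDiffAt
    (hpsm.of_le (by exact_mod_cast le_top)).contDiffAt, iteratedDeriv_poly, hder] at h
  simp only [eval_C] at h
  have hfac : (Nat.factorial l : ℝ) ≠ 0 := by positivity
  rw [sub_eq_zero.1 h]
  field_simp

theorem smooth_param (P : ℝ → ℝ → ℝ)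
    (h : ContDiff ℝ (⊤ : ℕ∞) (fun p : ℝ × ℝ => P p.1 p.2)) (l : ℕ) :
    ContDiff ℝ (⊤ : ℕ∞) (fun p : ℝ × ℝ => iteratedDeriv l (P p.1) p.2) := by
  induction l with
  | zero => simpa using h
  | succ l ih =>
    let F : ℝ × ℝ → ℝ := fun p => iteratedDeriv l (P p.1) p.2
    have hF : ContDiff ℝ (⊤ : ℕ∞) F := ih
    have e : (fun p : ℝ × ℝ => iteratedDeriv (l + 1) (P p.1) p.2) =
        fun p => fderiv ℝ F p (0, 1) := by
      funext p
      rw [iteratedDeriv_succ]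
      have h1 : HasFDerivAt F (fderiv ℝ F p) (p.1, p.2) :=
        ((hF.differentiable (by simp)) p).hasFDerivAt
      have h2 : HasDerivAt (fun t : ℝ => (p.1, t)) ((0 : ℝ), (1 : ℝ)) p.2 :=
        (hasDerivAt_const p.2 p.1).prodMk (hasDerivAt_id p.2)
      exact (h1.comp_hasDerivAt p.2 h2).deriv
    rw [e]
    exact (hF.fderiv_right (m := (⊤ : ℕ∞)) (by simp)).clm_apply contDiff_const

theorem det_le_of_col (n : ℕ) (C : Matrix (Fin n) (Fin n) ℝ) (m : ℕ → ℝ)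
    (h : ∀ i j : Fin n, |C i j| ≤ m j) :
    |C.det| ≤ (Nat.factorial n : ℝ) * ∏ l ∈ Finset.range n, m l := by
  rw [Matrix.det_apply]
  refine (Finset.abs_sum_le_sum_abs _ _).trans ?_
  have : ∀ σ ∈ (Finset.univ : Finset (Equiv.Perm (Fin n))),
      |Equiv.Perm.sign σ • ∏ i, C (σ i) i| ≤ ∏ l ∈ Finset.range n, m l := by
    intro σ _
    have e : |Equiv.Perm.sign σ • ∏ i, C (σ i) i| = ∏ i, |C (σ i) i| := by
      rw [← Finset.abs_prod]
      rcases Int.units_eq_one_or (Equiv.Perm.sign σ) with h | h <;> simp [h]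
    rw [e, Finset.prod_range]
    exact Finset.prod_le_prod (fun i _ => abs_nonneg _) fun i _ => h _ _
  refine (Finset.sum_le_card_nsmul _ _ _ this).trans ?_
  simp [Fintype.card_perm]

theorem pointwise (a b : ℝ) (hab : a ≤ b) (P : ℝ → ℝ → ℝ)
    (hsmooth : ContDiff ℝ (⊤ : ℕ∞) (fun p : ℝ × ℝ => P p.1 p.2)) (n : ℕ) (m : ℕ → ℝ)
    (hm : ∀ l, ∀ x ∈ Set.Icc a b, ∀ y ∈ Set.Icc a b,
      (Nat.factorial l : ℝ)⁻¹ * |iteratedDeriv l (P x) y| ≤ m l)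
    (x : Fin n → ℝ) (hx : ∀ i, x i ∈ Set.Icc a b) :
    |(Matrix.of fun i j => P (x i) (x j)).det| ≤
      (Nat.factorial n : ℝ) * (∏ l ∈ Finset.range n, m l) *
        ∏ l ∈ Finset.range n, (b - a) ^ l := by
  have hm0 : ∀ l, 0 ≤ m l := fun l =>
    le_trans (by positivity) (hm l a ⟨le_rfl, hab⟩ a ⟨le_rfl, hab⟩)
  have hba : 0 ≤ b - a := sub_nonneg.2 hab
  by_cases hinj : Function.Injective x
  swap
  · have : (Matrix.of fun i j => P (x i) (x j)).det = 0 := by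
      simp only [Function.Injective, not_forall] at hinj
      obtain ⟨i, j, hij, hne⟩ := hinj
      refine Matrix.det_zero_of_row_eq hne ?_
      funext k
      simp [hij]
    rw [this, abs_zero]
    exact mul_nonneg (mul_nonneg (by positivity) (Finset.prod_nonneg fun i _ => hm0 i))
      (Finset.prod_nonneg fun i _ => by positivity)
  let y : ℕ → ℝ := fun k => if h : k < n then x ⟨k, h⟩ else 0
  have hy : ∀ i : Fin n, y i = x i := fun i => by simp [y]
  have hyI : ∀ i < n, y i ∈ Set.Icc a b := fun i hi => by
    have := hy ⟨i, hi⟩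
    simp only at this
    rw [this]; exact hx _
  have hyinj : Set.InjOn y (Set.Iio n) := by
    intro i hi j hj h
    have h1 := hy ⟨i, hi⟩
    have h2 := hy ⟨j, hj⟩
    simp only at h1 h2
    rw [h1, h2] at h
    exact congrArg Fin.val (hinj h)
  have hPs : ∀ t, ContDiff ℝ (⊤ : ℕ∞) (P t) := fun t =>
    hsmooth.comp (contDiff_const.prodMk contDiff_id : ContDiff ℝ (⊤ : ℕ∞) fun s : ℝ => (t, s))
  let A : Matrix (Fin n) (Fin n) ℝ := Matrix.of fun i l => newton (P (x i)) y l
  let N : Matrix (Fin n) (Fin n) ℝ :=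
    Matrix.of fun l j => ∏ k ∈ Finset.range l, (y j - y k)
  have hfac : (Matrix.of fun i j => P (x i) (x j)) = A * N := by
    ext i j
    rw [Matrix.mul_apply]
    simp only [A, N, Matrix.of_apply]
    rw [← hy j, ← newton_interp (P (x i)) y n hyinj n j j.2 j.2, Finset.sum_range]
  have hN : N.det = ∏ i : Fin n, ∏ k ∈ Finset.range i, (y i - y k) := by
    rw [Matrix.det_of_upperTriangular]
    · rfl
    · intro i j hij
      simp only [id] at hij
      simp only [N, Matrix.of_apply]
      exact Finset.prod_eq_zero (i := (j : ℕ)) (by simpa using hij) (by simp)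
  rw [hfac, Matrix.det_mul, abs_mul]
  refine mul_le_mul ?_ ?_ (abs_nonneg _)
    (mul_nonneg (by positivity) (Finset.prod_nonneg fun i _ => hm0 i))
  · apply det_le_of_col
    intro i l
    obtain ⟨ξ, hξ, h⟩ := newton_mvt a b (P (x i)) (hPs _) y n hyinj hyI l l.2
    simp only [A, Matrix.of_apply]
    rw [h, abs_mul, abs_of_nonneg (by positivity : (0 : ℝ) ≤ (Nat.factorial (l : ℕ) : ℝ)⁻¹)]
    exact hm l _ (hx i) _ hξ
  · rw [hN, Finset.abs_prod, Finset.prod_range]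
    refine Finset.prod_le_prod (fun i _ => abs_nonneg _) fun i _ => ?_
    rw [Finset.abs_prod]
    calc ∏ k ∈ Finset.range i, |y i - y k| ≤ ∏ k ∈ Finset.range (i : ℕ), (b - a) := by
          refine Finset.prod_le_prod (fun _ _ => abs_nonneg _) fun k hk => ?_
          have h1 := hyI i i.2
          have h2 := hyI k ((Finset.mem_range.1 hk).trans i.2)
          rw [abs_le]
          constructor <;> linarith [h1.1, h1.2, h2.1, h2.2]
      _ = (b - a) ^ (i : ℕ) := by simp

end DetBound

theorem stmt3 (a b : ℝ) (hab : a ≤ b) (P : ℝ → ℝ → ℝ)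
    (hsmooth : ContDiff ℝ (⊤ : ℕ∞) (fun p : ℝ × ℝ => P p.1 p.2))
    (n : ℕ) (hn : 1 ≤ n) :
    |∫ x : Fin n → ℝ in Set.pi Set.univ (fun _ => Set.Icc a b),
        (Matrix.of fun i j => P (x i) (x j)).det| ≤
      (b - a) ^ (n * (n + 1) / 2) * (Nat.factorial n : ℝ) *
        ∏ l ∈ Finset.range n,
          ((Nat.factorial l : ℝ))⁻¹ *
            sSup {v : ℝ | ∃ x ∈ Set.Icc a b, ∃ y ∈ Set.Icc a b,
              v = |iteratedDeriv l (fun t => P x t) y|} := by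
  have hbdd : ∀ l : ℕ, BddAbove {v : ℝ | ∃ x ∈ Set.Icc a b, ∃ y ∈ Set.Icc a b,
              v = |iteratedDeriv l (fun t => P x t) y|} := by
    intro l
    have hc : Continuous (fun p : ℝ × ℝ => |iteratedDeriv l (P p.1) p.2|) :=
      (DetBound.smooth_param P hsmooth l).continuous.abs
    have := ((isCompact_Icc (a := a) (b := b)).prod
      (isCompact_Icc (a := a) (b := b))).bddAbove_image hc.continuousOn
    refine this.mono ?_
    rintro v ⟨x, hx, y, hy, rfl⟩
    exact ⟨(x, y), ⟨hx, hy⟩, rfl⟩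
  have hvol : volume (Set.pi Set.univ (fun _ : Fin n => Set.Icc a b)) =
      ENNReal.ofReal (b - a) ^ n := by
    rw [volume_pi_pi]
    simp
  have key := norm_setIntegral_le_of_norm_le_const (μ := volume)
    (s := Set.pi Set.univ (fun _ : Fin n => Set.Icc a b))
    (f := fun x : Fin n → ℝ => (Matrix.of fun i j => P (x i) (x j)).det)
    (by rw [hvol]; exact ENNReal.pow_lt_top ENNReal.ofReal_lt_top)
    (fun x hx => DetBound.pointwise a b hab P hsmooth n _
      (fun l x hx y hy => mul_le_mul_of_nonneg_left
        (le_csSup (hbdd l) ⟨x, hx, y, hy, rfl⟩) (by positivity)) x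
        (fun i => hx i (Set.mem_univ i)))
  rw [Real.norm_eq_abs] at key
  refine key.trans (le_of_eq ?_)
  rw [Measure.real, hvol, ENNReal.toReal_pow, ENNReal.toReal_ofReal (sub_nonneg.2 hab),
    mul_assoc _ (∏ l ∈ Finset.range n, (b - a) ^ l), ← Finset.prod_range_succ,
    Finset.prod_pow_eq_pow_sum, Finset.sum_range_id, Nat.add_sub_cancel, Nat.mul_comm (n + 1) n]
  ring
end

section
/- Let I = [a,b] ⊂ ℝ be a compact interval, r ≥ 1, and let K : ℝ × ℝ → Mat_{r×r}(ℝ) be a matrix-valued function each of whose entries is infinitely differentiable. For l ≥ 0 set m_l(K,I) = (1/l!)·max_{x,y ∈ I; 1 ≤ i,j ≤ r} |∂^l K(x,y)_{ij}/∂y^l|. For points x₁,…,xₙ ∈ ℝ let M be the (rn)×(rn) block matrix whose (i,j) block (1 ≤ i,j ≤ n) is the r×r matrix K(x_i,x_j). Then for every n ≥ 1, |∫_{Iⁿ} det(M(x₁,…,xₙ)) dx₁⋯dxₙ| ≤ (b−a)^{n + r·n(n−1)/2} · (rn)! · (∏_{l=0}^{n−1} m_l(K,I))^r. -/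
open MeasureTheory

lemma aux_rolle (a b : ℝ) (n : ℕ) : ∀ (f : ℝ → ℝ), ContDiff ℝ (⊤ : ℕ∞) f →
    ∀ z : Fin (n+1) → ℝ, StrictMono z → (∀ i, z i ∈ Set.Icc a b) → (∀ i, f (z i) = 0) →
    ∃ ξ ∈ Set.Icc a b, iteratedDeriv n f ξ = 0 := by
  induction n with
  | zero =>
    intro f hf z hz hI h0
    exact ⟨z 0, hI 0, by simpa using h0 0⟩
  | succ n ih =>
    intro f hf z hz hI h0
    have h : ∀ i : Fin (n+1), ∃ w ∈ Set.Ioo (z i.castSucc) (z i.succ), deriv f w = 0 := fun i =>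
      exists_deriv_eq_zero (hz (Fin.castSucc_lt_succ)) hf.continuous.continuousOn
        (by rw [h0, h0])
    choose w hw hw0 using h
    have hd : ContDiff ℝ (⊤ : ℕ∞) (deriv f) := (contDiff_infty_iff_deriv.1 hf).2
    obtain ⟨ξ, hξ, h⟩ := ih (deriv f) hd w
      (by
        refine Fin.strictMono_iff_lt_succ.2 fun i => ?_
        exact (hw _).2.trans_le (le_of_eq_of_le (by rw [Fin.succ_castSucc]) (hw i.succ).1.le) )
      (fun i => ⟨(hI _).1.trans (hw i).1.le, (hw i).2.le.trans (hI _).2⟩) hw0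
    exact ⟨ξ, hξ, by rw [iteratedDeriv_succ']; exact h⟩

lemma aux_rolle' (a b : ℝ) (n : ℕ) (f : ℝ → ℝ) (hf : ContDiff ℝ (⊤ : ℕ∞) f)
    (x : ℕ → ℝ) (hx : Set.InjOn x (Set.Iio (n+1)))
    (hI : ∀ i < n+1, x i ∈ Set.Icc a b) (h0 : ∀ i < n+1, f (x i) = 0) :
    ∃ ξ ∈ Set.Icc a b, iteratedDeriv n f ξ = 0 := by
  have hc : ((Finset.range (n+1)).image x).card = n+1 := by
    rw [Finset.card_image_of_injOn (by simpa using hx), Finset.card_range]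
  have hm : ∀ i, ((Finset.range (n+1)).image x).orderEmbOfFin hc i ∈ (Finset.range (n+1)).image x :=
    fun i => Finset.orderEmbOfFin_mem _ _ _
  refine aux_rolle a b n f hf (((Finset.range (n+1)).image x).orderEmbOfFin hc)
    (OrderEmbedding.strictMono _) (fun i => ?_) (fun i => ?_)
  · obtain ⟨j, hj, e⟩ := Finset.mem_image.1 (hm i)
    rw [← e]; exact hI j (by simpa using hj)
  · obtain ⟨j, hj, e⟩ := Finset.mem_image.1 (hm i)
    rw [← e]; exact h0 j (by simpa using hj)

open Polynomial in
lemma aux_iter (P : ℝ[X]) (k : ℕ) : 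
    iteratedDeriv k (fun t => P.eval t) = fun t => (derivative^[k] P).eval t := by
  induction k with
  | zero => simp
  | succ k ih =>
    rw [iteratedDeriv_succ, ih, Function.iterate_succ_apply']
    ext t
    simp

open Polynomial in
/-- Newton basis -/
noncomputable def auxN (x : ℕ → ℝ) (k : ℕ) : ℝ[X] := ∏ i ∈ Finset.range k, (X - C (x i))

open Polynomial in
lemma aux_newton (a b : ℝ) (f : ℝ → ℝ) (hf : ContDiff ℝ (⊤ : ℕ∞) f) (m : ℕ → ℝ)
    (hm : ∀ l, ∀ y ∈ Set.Icc a b, |iteratedDeriv l f y| ≤ m l)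
    (n : ℕ) (x : ℕ → ℝ) (hx : Set.InjOn x (Set.Iio n))
    (hI : ∀ i < n, x i ∈ Set.Icc a b) :
    ∃ c : ℕ → ℝ, (∀ j < n, f (x j) = ∑ k ∈ Finset.range n, c k * (auxN x k).eval (x j)) ∧
      ∀ k < n, |c k| ≤ (Nat.factorial k : ℝ)⁻¹ * m k := by
  induction n with
  | zero => exact ⟨0, by simp, by simp⟩
  | succ n ih =>
    obtain ⟨c, hc, hb⟩ := ih (hx.mono (by intro i; simp; omega)) (fun i hi => hI i (by omega))
    have hN0 : ∀ j < n, (auxN x n).eval (x j) = 0 := by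
      intro j hj
      rw [auxN, eval_prod]
      exact Finset.prod_eq_zero (Finset.mem_range.2 hj) (by simp)
    have hNn : (auxN x n).eval (x n) ≠ 0 := by
      rw [auxN, eval_prod, Finset.prod_ne_zero_iff]
      intro i hi
      have hi := Finset.mem_range.1 hi
      simp only [eval_sub, eval_X, eval_C]
      intro h
      have := hx (by simp) (by simp; omega) (sub_eq_zero.1 h)
      omega
    set d : ℝ := (f (x n) - ∑ k ∈ Finset.range n, c k * (auxN x k).eval (x n)) /
      (auxN x n).eval (x n) with hd
    set c' : ℕ → ℝ := fun k => if k = n then d else c k with hc'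
    have hlt : ∀ k ∈ Finset.range n, c' k = c k := by
      intro k hk
      have hk := Finset.mem_range.1 hk
      simp [hc', hk.ne]
    have hn' : c' n = d := by simp [hc']
    have hint : ∀ j < n+1, f (x j) = ∑ k ∈ Finset.range (n+1), c' k * (auxN x k).eval (x j) := by
      intro j hj
      rw [Finset.sum_range_succ, hn', Finset.sum_congr rfl (fun k hk => by rw [hlt k hk])]
      rcases Nat.lt_succ_iff_lt_or_eq.1 hj with h | rfl
      · rw [hN0 j h, mul_zero, add_zero, hc j h]
      · rw [hd, div_mul_cancel₀ _ hNn]; ring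
    refine ⟨c', hint, ?_⟩
    intro k hk
    rcases Nat.lt_succ_iff_lt_or_eq.1 hk with h | rfl
    · rw [hlt k (Finset.mem_range.2 h)]; exact hb k h
    · set P : ℝ[X] := ∑ i ∈ Finset.range (k+1), C (c' i) * auxN x i with hP
      have hmon : ∀ i, (auxN x i).Monic := fun i => monic_prod_of_monic _ _ fun j _ => monic_X_sub_C _
      have hdeg : ∀ i, (auxN x i).natDegree = i := by
        intro i
        rw [auxN, natDegree_prod_of_monic _ _ (fun j _ => monic_X_sub_C _)]
        simp
      have hPe : ∀ t, P.eval t = ∑ i ∈ Finset.range (k+1), c' i * (auxN x i).eval t := by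
        intro t; simp [hP, eval_finsetSum]
      have hPdeg : P.natDegree ≤ k := by
        refine natDegree_sum_le_of_forall_le _ _ fun i hi => ?_
        refine (natDegree_C_mul_le _ _).trans ?_
        rw [hdeg]
        have := Finset.mem_range.1 hi
        omega
      have hPc : P.coeff k = c' k := by
        rw [hP, finsetSum_coeff, Finset.sum_range_succ, Finset.sum_eq_zero, zero_add, coeff_C_mul]
        · have := (hmon k).coeff_natDegree
          rw [hdeg] at this
          rw [this, mul_one]
        · intro i hi
          rw [coeff_C_mul, coeff_eq_zero_of_natDegree_lt, mul_zero]
          rw [hdeg]; exact Finset.mem_range.1 hi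
      have hder : derivative^[k] P = C ((k.factorial : ℝ) * c' k) := by
        have h1 : (derivative^[k] P).natDegree ≤ 0 := by
          have := natDegree_iterate_derivative P k
          omega
        rw [eq_C_of_natDegree_le_zero h1, coeff_iterate_derivative]
        simp [hPc, Nat.descFactorial_self]
      have hPs : ContDiff ℝ (⊤ : ℕ∞) (fun t => P.eval t) := by
        simpa [Polynomial.coe_aeval_eq_eval] using P.contDiff_aeval (𝕜 := ℝ) ((⊤ : ℕ∞) : WithTop ℕ∞)
      obtain ⟨ξ, hξ, h0⟩ := aux_rolle' a b k (f - fun t => P.eval t) (hf.sub hPs) x hx hI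
        (by intro i hi; simp [hint i hi, hPe])
      have hfk : ContDiff ℝ k f := hf.of_le (by exact_mod_cast le_top)
      have hPk : ContDiff ℝ k (fun t => P.eval t) := hPs.of_le (by exact_mod_cast le_top)
      rw [iteratedDeriv_sub hfk.contDiffAt hPk.contDiffAt, aux_iter, hder] at h0
      simp only [eval_C] at h0
      have h2 : iteratedDeriv k f ξ = (k.factorial : ℝ) * c' k := by linarith
      have h3 := hm k ξ hξ
      have hpos : (0:ℝ) < k.factorial := by exact_mod_cast k.factorial_pos
      rw [h2, abs_mul, abs_of_pos hpos] at h3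
      rw [inv_mul_eq_div, le_div_iff₀ hpos, mul_comm]
      exact h3

lemma aux_partial (G : ℝ → ℝ → ℝ) (hG : ContDiff ℝ (⊤ : ℕ∞) (fun p : ℝ × ℝ => G p.1 p.2)) (l : ℕ) :
    ContDiff ℝ (⊤ : ℕ∞) (fun p : ℝ × ℝ => iteratedDeriv l (G p.1) p.2) := by
  induction l with
  | zero => simpa using hG
  | succ l ih =>
    have e : (fun p : ℝ × ℝ => iteratedDeriv (l+1) (G p.1) p.2) = fun p =>
        fderiv ℝ (fun p : ℝ × ℝ => iteratedDeriv l (G p.1) p.2) p (0, 1) := by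
      ext p
      rw [iteratedDeriv_succ]
      have h1 := (ih.differentiable (by simp) p).hasFDerivAt
      have h2 : HasDerivAt (fun t : ℝ => (p.1, t)) ((0:ℝ), (1:ℝ)) p.2 :=
        (hasDerivAt_const _ _).prodMk (hasDerivAt_id _)
      exact (HasFDerivAt.comp_hasDerivAt (f := fun t : ℝ => (p.1, t)) p.2 h1 h2).deriv
    rw [e]
    exact (ih.fderiv_right (m := (⊤ : ℕ∞)) (by simp)).clm_apply contDiff_const

lemma aux_bdd (a b : ℝ) (r : ℕ)
    (K : ℝ → ℝ → Matrix (Fin r) (Fin r) ℝ)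
    (hsmooth : ∀ i j : Fin r, ContDiff ℝ (⊤ : ℕ∞) (fun p : ℝ × ℝ => K p.1 p.2 i j)) (l : ℕ) :
    BddAbove {v : ℝ | ∃ x ∈ Set.Icc a b, ∃ y ∈ Set.Icc a b, ∃ i : Fin r, ∃ j : Fin r,
              v = |iteratedDeriv l (fun t => K x t i j) y|} := by
  have h : ∀ i j : Fin r, ∃ B, ∀ p ∈ Set.Icc a b ×ˢ Set.Icc a b,
      |iteratedDeriv l (fun t => K p.1 t i j) p.2| ≤ B := by
    intro i j
    have hc := (aux_partial (fun x t => K x t i j) (hsmooth i j) l).continuous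
    exact (isCompact_Icc.prod isCompact_Icc).exists_bound_of_continuousOn hc.continuousOn
  choose B hB using h
  refine ⟨∑ i, ∑ j, |B i j|, ?_⟩
  rintro v ⟨x, hx, y, hy, i, j, rfl⟩
  calc _ ≤ B i j := hB i j (x, y) ⟨hx, hy⟩
    _ ≤ |B i j| := le_abs_self _
    _ ≤ ∑ j, |B i j| := Finset.single_le_sum (f := fun j => |B i j|) (fun _ _ => abs_nonneg _) (Finset.mem_univ j)
    _ ≤ _ := Finset.single_le_sum (f := fun i => ∑ j, |B i j|)
        (fun _ _ => Finset.sum_nonneg fun _ _ => abs_nonneg _) (Finset.mem_univ i)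

lemma aux_det_le {ι : Type*} [Fintype ι] [DecidableEq ι] (A : Matrix ι ι ℝ) (m : ι → ℝ)
    (h : ∀ i j, |A i j| ≤ m j) : |A.det| ≤ (Fintype.card ι).factorial * ∏ j, m j := by
  rw [Matrix.det_apply]
  calc _ ≤ ∑ σ : Equiv.Perm ι, |Equiv.Perm.sign σ • ∏ i, A (σ i) i| := Finset.abs_sum_le_sum_abs _ _
    _ = ∑ σ : Equiv.Perm ι, ∏ i, |A (σ i) i| := by
      refine Finset.sum_congr rfl fun σ _ => ?_
      rw [← Finset.abs_prod]
      rcases Int.units_eq_one_or (Equiv.Perm.sign σ) with e | e <;> simp [e]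
    _ ≤ ∑ σ : Equiv.Perm ι, ∏ i, m i := by
      refine Finset.sum_le_sum fun σ _ => ?_
      exact Finset.prod_le_prod (fun _ _ => abs_nonneg _) fun i _ => h _ _
    _ = _ := by simp [Fintype.card_perm]

lemma aux_point (a b : ℝ) (hab : a ≤ b) (r : ℕ) (hr : 1 ≤ r)
    (K : ℝ → ℝ → Matrix (Fin r) (Fin r) ℝ)
    (hsmooth : ∀ i j : Fin r, ContDiff ℝ (⊤ : ℕ∞) (fun p : ℝ × ℝ => K p.1 p.2 i j))
    (n : ℕ) (m : ℕ → ℝ) (hm0 : ∀ l, 0 ≤ m l)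
    (hm : ∀ l, ∀ x ∈ Set.Icc a b, ∀ y ∈ Set.Icc a b, ∀ i j,
      |iteratedDeriv l (fun t => K x t i j) y| ≤ m l)
    (x : Fin n → ℝ) (hx : ∀ i, x i ∈ Set.Icc a b) :
    |(Matrix.of fun p q : Fin n × Fin r => K (x p.1) (x q.1) p.2 q.2).det| ≤
      (b - a) ^ (r * (n * (n - 1) / 2)) * (Nat.factorial (r * n) : ℝ) *
        (∏ l ∈ Finset.range n, ((Nat.factorial l : ℝ))⁻¹ * m l) ^ r := by
  have hba : 0 ≤ b - a := sub_nonneg.2 hab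
  have hp0 : 0 ≤ ∏ l ∈ Finset.range n, ((Nat.factorial l : ℝ))⁻¹ * m l :=
    Finset.prod_nonneg fun l _ => mul_nonneg (by positivity) (hm0 l)
  by_cases hinj : Function.Injective x
  swap
  · simp only [Function.Injective, not_forall] at hinj
    obtain ⟨i, j, hij, hne⟩ := hinj
    rw [Matrix.det_zero_of_column_eq (i := (i, (⟨0, hr⟩ : Fin r))) (j := (j, ⟨0, hr⟩))]
    · rw [abs_zero]; positivity
    · simpa using hne
    · intro k; simp [hij]
  set y : ℕ → ℝ := fun i => if h : i < n then x ⟨i, h⟩ else a with hy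
  have hyx : ∀ i : Fin n, y i = x i := by intro i; simp [hy]
  have hyI : ∀ i < n, y i ∈ Set.Icc a b := by
    intro i hi; rw [hyx ⟨i, hi⟩]; exact hx _
  have hyinj : Set.InjOn y (Set.Iio n) := by
    intro i hi j hj h
    have h' : x ⟨i, hi⟩ = x ⟨j, hj⟩ := by rw [← hyx, ← hyx]; exact h
    exact congrArg Fin.val (hinj h')
  have hnewt : ∀ (p : Fin n × Fin r) (q : Fin r), ∃ c : ℕ → ℝ,
      (∀ j < n, K (x p.1) (y j) p.2 q = ∑ k ∈ Finset.range n, c k * (auxN y k).eval (y j)) ∧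
      ∀ k < n, |c k| ≤ (Nat.factorial k : ℝ)⁻¹ * m k := by
    intro p q
    refine aux_newton a b (fun t => K (x p.1) t p.2 q) ?_ m ?_ n y hyinj hyI
    · exact (hsmooth p.2 q).comp (contDiff_const.prodMk contDiff_id)
    · intro l t ht; exact hm l _ (hx _) t ht _ _
  choose c hc hcb using hnewt
  let A : Matrix (Fin n × Fin r) (Fin n × Fin r) ℝ := Matrix.of fun p q => c p q.2 q.1
  let V : Matrix (Fin n) (Fin n) ℝ := Matrix.of fun k j => (auxN y k).eval (y j)
  have hM : (Matrix.of fun p q : Fin n × Fin r => K (x p.1) (x q.1) p.2 q.2) =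
      A * Matrix.kroneckerMap (· * ·) V (1 : Matrix (Fin r) (Fin r) ℝ) := by
    ext p q
    rw [Matrix.mul_apply, Fintype.sum_prod_type]
    simp only [Matrix.of_apply, Matrix.kroneckerMap_apply, Matrix.one_apply, A, V]
    rw [← hyx q.1, hc p q.2 q.1 q.1.2, Finset.sum_range]
    simp
  have hdet := Matrix.det_kronecker V (1 : Matrix (Fin r) (Fin r) ℝ)
  rw [Matrix.det_one, one_pow, mul_one, Fintype.card_fin] at hdet
  rw [hM, Matrix.det_mul, hdet, abs_mul, abs_pow]
  have hV : |V.det| ≤ (b-a)^(n * (n-1)/2) := by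
    have hup : V.det = ∏ i, V i i := by
      apply Matrix.det_of_isUpperTriangular
      intro k j hkj
      simp only [V, Matrix.of_apply, auxN, Polynomial.eval_prod]
      exact Finset.prod_eq_zero (Finset.mem_range.2 (show (j:ℕ) < k from hkj)) (by simp)
    rw [hup, Finset.abs_prod]
    calc _ ≤ ∏ i : Fin n, (b-a)^(i:ℕ) := by
          refine Finset.prod_le_prod (fun _ _ => abs_nonneg _) fun i _ => ?_
          simp only [V, Matrix.of_apply, auxN, Polynomial.eval_prod, Finset.abs_prod]
          calc _ ≤ ∏ k ∈ Finset.range (i:ℕ), (b-a) := by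
                refine Finset.prod_le_prod (fun _ _ => abs_nonneg _) fun k hk => ?_
                have h1 := hyI i i.2
                have h2 := hyI k ((Finset.mem_range.1 hk).trans i.2)
                simp only [Polynomial.eval_sub, Polynomial.eval_X, Polynomial.eval_C]
                rw [abs_le]
                constructor <;> linarith [h1.1, h1.2, h2.1, h2.2]
            _ = _ := by simp
      _ = _ := by
        rw [Finset.prod_pow_eq_pow_sum, ← Finset.sum_range (fun i => i), Finset.sum_range_id]
  have hA : |A.det| ≤ (r*n).factorial * (∏ l ∈ Finset.range n, ((Nat.factorial l : ℝ))⁻¹ * m l) ^ r := by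
    refine (aux_det_le A (fun q => ((Nat.factorial q.1 : ℝ))⁻¹ * m q.1) ?_).trans_eq ?_
    · intro p q; exact hcb p q.2 q.1 q.1.2
    · rw [Fintype.prod_prod_type, Finset.prod_range, ← Finset.prod_pow]
      simp [mul_comm]
  calc _ ≤ ((r*n).factorial * (∏ l ∈ Finset.range n, ((Nat.factorial l : ℝ))⁻¹ * m l) ^ r) *
        ((b-a)^(n * (n-1)/2))^r := by gcongr
    _ = _ := by rw [← pow_mul, mul_comm _ r]; ring

theorem stmt4 (a b : ℝ) (hab : a ≤ b) (r : ℕ) (hr : 1 ≤ r)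
    (K : ℝ → ℝ → Matrix (Fin r) (Fin r) ℝ)
    (hsmooth : ∀ i j : Fin r, ContDiff ℝ (⊤ : ℕ∞) (fun p : ℝ × ℝ => K p.1 p.2 i j))
    (n : ℕ) (hn : 1 ≤ n) :
    |∫ x : Fin n → ℝ in Set.pi Set.univ (fun _ => Set.Icc a b),
        (Matrix.of fun p q : Fin n × Fin r => K (x p.1) (x q.1) p.2 q.2).det| ≤
      (b - a) ^ (n + r * (n * (n - 1) / 2)) * (Nat.factorial (r * n) : ℝ) *
        (∏ l ∈ Finset.range n,
          ((Nat.factorial l : ℝ))⁻¹ *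
            sSup {v : ℝ | ∃ x ∈ Set.Icc a b, ∃ y ∈ Set.Icc a b, ∃ i : Fin r, ∃ j : Fin r,
              v = |iteratedDeriv l (fun t => K x t i j) y|}) ^ r := by
  set m : ℕ → ℝ := fun l => sSup {v : ℝ | ∃ x ∈ Set.Icc a b, ∃ y ∈ Set.Icc a b, ∃ i : Fin r,
    ∃ j : Fin r, v = |iteratedDeriv l (fun t => K x t i j) y|} with hmdef
  have hm0 : ∀ l, 0 ≤ m l := by
    intro l
    apply Real.sSup_nonneg
    rintro v ⟨x, hx, y, hy, i, j, rfl⟩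
    exact abs_nonneg _
  have hm : ∀ l, ∀ x ∈ Set.Icc a b, ∀ y ∈ Set.Icc a b, ∀ i j,
      |iteratedDeriv l (fun t => K x t i j) y| ≤ m l := by
    intro l x hx y hy i j
    exact le_csSup (aux_bdd a b r K hsmooth l) ⟨x, hx, y, hy, i, j, rfl⟩
  have hvol : volume (Set.pi Set.univ (fun _ : Fin n => Set.Icc a b)) = ENNReal.ofReal (b-a) ^ n := by
    rw [volume_pi_pi]; simp
  have key := norm_setIntegral_le_of_norm_le_const (μ := volume)
    (s := Set.pi Set.univ (fun _ : Fin n => Set.Icc a b))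
    (f := fun x => (Matrix.of fun p q : Fin n × Fin r => K (x p.1) (x q.1) p.2 q.2).det)
    (C := (b - a) ^ (r * (n * (n - 1) / 2)) * (Nat.factorial (r * n) : ℝ) *
        (∏ l ∈ Finset.range n, ((Nat.factorial l : ℝ))⁻¹ * m l) ^ r)
    (by rw [hvol]; exact ENNReal.pow_lt_top ENNReal.ofReal_lt_top)
    (fun x hx => aux_point a b hab r hr K hsmooth n m hm0 hm x (fun i => hx i (Set.mem_univ i)))
  rw [Real.norm_eq_abs] at key
  refine key.trans_eq ?_
  rw [Measure.real, hvol, ENNReal.toReal_pow, ENNReal.toReal_ofReal (sub_nonneg.2 hab), pow_add]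
  ring
end

section
/- Let f : ℝ × ℝ → ℝ be any function and let x₁,…,xₙ ∈ ℝ be pairwise distinct points. For 1 ≤ i,l ≤ n define the divided difference D_{il} = Σ_{j=1}^{l} f(x_i, x_j) / ∏_{1 ≤ m ≤ l, m ≠ j} (x_j − x_m). Then det(f(x_i,x_j))_{i,j=1,…,n} = (∏_{1 ≤ m < j ≤ n} (x_j − x_m)) · det(D_{il})_{i,l=1,…,n}. -/
theorem stmt6 (f : ℝ → ℝ → ℝ) (n : ℕ) (x : Fin n → ℝ) (hx : Function.Injective x) :
    (Matrix.of fun i j => f (x i) (x j)).det =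
      (∏ j : Fin n, ∏ m ∈ Finset.univ.filter (fun m => m < j), (x j - x m)) *
        (Matrix.of fun i l : Fin n =>
          ∑ j ∈ Finset.univ.filter (fun j => j ≤ l),
            f (x i) (x j) /
              ∏ m ∈ Finset.univ.filter (fun m => m ≤ l ∧ m ≠ j), (x j - x m)).det := by
  classical
  let U : Matrix (Fin n) (Fin n) ℝ := Matrix.of fun j l =>
    if j ≤ l then (∏ m ∈ Finset.univ.filter (fun m => m ≤ l ∧ m ≠ j), (x j - x m))⁻¹ else 0
  have hmul : (Matrix.of fun i l : Fin n =>
          ∑ j ∈ Finset.univ.filter (fun j => j ≤ l),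
            f (x i) (x j) /
              ∏ m ∈ Finset.univ.filter (fun m => m ≤ l ∧ m ≠ j), (x j - x m))
      = (Matrix.of fun i j => f (x i) (x j)) * U := by
    ext i l
    simp only [Matrix.mul_apply, Matrix.of_apply, U, Finset.sum_filter, div_eq_mul_inv,
      mul_ite, mul_zero]
  have hU : U.det = ∏ j : Fin n, (∏ m ∈ Finset.univ.filter (fun m => m < j), (x j - x m))⁻¹ := by
    rw [Matrix.det_of_isUpperTriangular]
    · refine Finset.prod_congr rfl fun j _ => ?_
      simp only [U, Matrix.of_apply, le_refl, if_true]
      congr 2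
      ext m
      simp [lt_iff_le_and_ne]
    · intro i j hij
      have h : j < i := hij
      simp [U, not_le.mpr h]
  have hne : (∏ j : Fin n, ∏ m ∈ Finset.univ.filter (fun m => m < j), (x j - x m)) ≠ 0 := by
    refine Finset.prod_ne_zero_iff.mpr fun j _ => Finset.prod_ne_zero_iff.mpr fun m hm => ?_
    have h : m < j := by simpa using hm
    exact sub_ne_zero.mpr fun e => h.ne' (hx e)
  rw [hmul, Matrix.det_mul, hU, Finset.prod_inv_distrib]
  field_simp
end

section
/- Let B > 0, δ > 0, and let ρ : [1,∞) → ℝ be a measurable nonnegative function satisfying ρ(t) ≤ exp(B·t − δ·t·log t) for all t ≥ 1. Then there exist positive constants c₁, c₂ such that for all λ > 0, ∫_1^∞ e^{λt}·ρ(t) dt ≤ exp(c₁·exp(λ/δ) + c₂). -/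
open MeasureTheory

theorem stmt9 (B δ : ℝ) (hB : 0 < B) (hδ : 0 < δ) (ρ : ℝ → ℝ)
    (hmeas : Measurable ρ) (hnonneg : ∀ t : ℝ, 1 ≤ t → 0 ≤ ρ t)
    (hbound : ∀ t : ℝ, 1 ≤ t → ρ t ≤ Real.exp (B * t - δ * t * Real.log t)) :
    ∃ c₁ > 0, ∃ c₂ > 0, ∀ lam : ℝ, 0 < lam →
      ∫⁻ t in Set.Ici (1 : ℝ), ENNReal.ofReal (Real.exp (lam * t) * ρ t) ≤
        ENNReal.ofReal (Real.exp (c₁ * Real.exp (lam / δ) + c₂)) := by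
  refine ⟨δ * Real.exp ((B + 1) / δ), by positivity, 1, one_pos, fun lam hlam => ?_⟩
  set C := δ * Real.exp ((B + 1) / δ) * Real.exp (lam / δ) with hC
  have key : ∀ t : ℝ, 1 ≤ t → Real.exp (lam * t) * ρ t ≤ Real.exp C * Real.exp (-t) := by
    intro t ht
    have ht0 : 0 < t := by linarith
    calc Real.exp (lam * t) * ρ t
        ≤ Real.exp (lam * t) * Real.exp (B * t - δ * t * Real.log t) :=
          mul_le_mul_of_nonneg_left (hbound t ht) (Real.exp_pos _).le
      _ = Real.exp (lam * t + (B * t - δ * t * Real.log t)) := (Real.exp_add _ _).symm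
      _ ≤ Real.exp (C + -t) := by
          apply Real.exp_le_exp.mpr
          set a := (B + 1) / δ + lam / δ with ha
          have h1 : a - Real.log t ≤ Real.exp a / t := by
            have h := Real.add_one_le_exp (a - Real.log t)
            rw [Real.exp_sub, Real.exp_log ht0] at h
            linarith
          have h2 : (a - Real.log t) * t ≤ Real.exp a := (le_div_iff₀ ht0).mp h1
          have h3 : C = δ * Real.exp a := by rw [hC, ha, Real.exp_add]; ring
          have h4 : δ * a = B + 1 + lam := by rw [ha]; field_simp
          have h5 := mul_le_mul_of_nonneg_left h2 hδ.le
          have h6 : δ * ((a - Real.log t) * t) = (B + 1 + lam) * t - δ * t * Real.log t := by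
            rw [← h4]; ring
          rw [h3]
          linarith
      _ = _ := Real.exp_add _ _
  calc ∫⁻ t in Set.Ici (1 : ℝ), ENNReal.ofReal (Real.exp (lam * t) * ρ t)
      ≤ ∫⁻ t in Set.Ici (1 : ℝ), ENNReal.ofReal (Real.exp C * Real.exp (-t)) :=
        setLIntegral_mono' measurableSet_Ici
          fun t ht => ENNReal.ofReal_le_ofReal (key t ht)
    _ = ∫⁻ t in Set.Ioi (1 : ℝ), ENNReal.ofReal (Real.exp C * Real.exp (-t)) :=
        (setLIntegral_congr Ioi_ae_eq_Ici).symm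
    _ = ENNReal.ofReal (∫ t in Set.Ioi (1 : ℝ), Real.exp C * Real.exp (-t)) := by
        rw [ofReal_integral_eq_lintegral_ofReal]
        · exact (integrableOn_exp_neg_Ioi 1).const_mul _
        · exact Filter.Eventually.of_forall fun t => by positivity
    _ ≤ _ := by
        apply ENNReal.ofReal_le_ofReal
        rw [integral_const_mul, integral_exp_neg_Ioi, ← Real.exp_add]
        apply Real.exp_le_exp.mpr
        linarith
end

section
/- Let Ψ : ℝ → ℝ be convex and monotone nondecreasing on [0,∞), with Ψ(0) = 1, and suppose Ψ has right derivative d₀ > 0 at 0 (i.e., Ψ is differentiable at 0 from within [0,∞) with derivative d₀ > 0). Then there exists a constant d > 0 such that for all λ > 0, min(exp(Ψ(λ)), 1 + λ·exp(Ψ(λ))) ≤ exp(d·(Ψ(λ) − 1)). -/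
theorem stmt10 (Ψ : ℝ → ℝ) (hconv : ConvexOn ℝ (Set.Ici (0 : ℝ)) Ψ)
    (hmono : MonotoneOn Ψ (Set.Ici (0 : ℝ))) (hΨ0 : Ψ 0 = 1)
    (d₀ : ℝ) (hd₀ : 0 < d₀)
    (hderiv : HasDerivWithinAt Ψ d₀ (Set.Ici (0 : ℝ)) 0) :
    ∃ d > 0, ∀ lam : ℝ, 0 < lam →
      min (Real.exp (Ψ lam)) (1 + lam * Real.exp (Ψ lam)) ≤
        Real.exp (d * (Ψ lam - 1)) := by
  have hE := Real.exp_pos 2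
  have hq : 0 < Real.exp 2 / d₀ := by positivity
  refine ⟨2 + Real.exp 2 / d₀, by positivity, fun lam hl => ?_⟩
  have hs : d₀ ≤ slope Ψ 0 lam :=
    hconv.le_slope_of_hasDerivWithinAt_Ioi (by simp) (by simpa using hl.le) hl
      (hderiv.mono Set.Ioi_subset_Ici_self)
  rw [slope_def_field, hΨ0, sub_zero, le_div_iff₀ hl] at hs
  have hp : 0 < d₀ * lam := by positivity
  have ht : 0 < Ψ lam - 1 := by linarith
  have hqt : 0 < Real.exp 2 / d₀ * (Ψ lam - 1) := by positivity
  rcases le_total 1 (Ψ lam - 1) with h | h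
  · refine (min_le_left _ _).trans (Real.exp_le_exp.2 ?_)
    nlinarith
  · refine (min_le_right _ _).trans ?_
    have h1 : Real.exp (Ψ lam) ≤ Real.exp 2 := Real.exp_le_exp.2 (by linarith)
    have h2 : lam * Real.exp (Ψ lam) ≤ Real.exp 2 / d₀ * (Ψ lam - 1) := by
      calc lam * Real.exp (Ψ lam) ≤ lam * Real.exp 2 := by gcongr
        _ = Real.exp 2 / d₀ * (d₀ * lam) := by field_simp
        _ ≤ _ := by gcongr
    have h3 := Real.add_one_le_exp ((2 + Real.exp 2 / d₀) * (Ψ lam - 1))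
    nlinarith
end

section
/- Define the sine kernel S : ℝ × ℝ → ℝ by S(x,y) = sin(π(x−y))/(π(x−y)) for x ≠ y and S(x,x) = 1. Then there exists a constant B > 0 such that for every a ∈ ℝ, every n ≥ 1, and all points x₁,…,xₙ ∈ [a, a+1], |det(S(x_i,x_j))_{i,j=1,…,n}| ≤ exp(B·n² − (1/2)·n²·log n). -/
noncomputable def sineKernel (x y : ℝ) : ℝ :=
  if x = y then 1 else Real.sin (Real.pi * (x - y)) / (Real.pi * (x - y))

open Finset in
theorem aux_final (n : ℕ) :
    (n.factorial : ℝ) * ∏ k ∈ Finset.range n, ((4 * Real.exp 4) ^ k * Real.exp 4 / (k.factorial : ℝ)) ≤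
      Real.exp (10 * n ^ 2 - (1 / 2) * n ^ 2 * Real.log n) := by
  induction n with
  | zero => simp
  | succ n ih =>
    have hn1 : (0 : ℝ) < (n : ℝ) + 1 := by positivity
    have hf : (0 : ℝ) < (n.factorial : ℝ) := by positivity
    have hfac : Real.exp (n * Real.log (n + 1) - n - 1) ≤ (n.factorial : ℝ) := by
      have h := Real.pow_div_factorial_le_exp (n + 1 : ℝ) hn1.le (n + 1)
      rw [div_le_iff₀ (by positivity), Nat.factorial_succ, pow_succ] at h
      push_cast at h
      have h2 : ((n : ℝ) + 1) ^ n ≤ Real.exp (n + 1) * n.factorial := by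
        refine le_of_mul_le_mul_right ?_ hn1
        linarith
      have h3 : Real.exp (n * Real.log (n + 1)) = ((n : ℝ) + 1) ^ n := by
        rw [Real.exp_nat_mul, Real.exp_log hn1]
      rw [show (n : ℝ) * Real.log (n + 1) - n - 1 = n * Real.log (n + 1) - (n + 1) by ring,
        Real.exp_sub, h3, div_le_iff₀ (Real.exp_pos _)]
      linarith
    have hlog4 : (4 : ℝ) ≤ Real.exp 3 := by
      have := Real.add_one_le_exp (3 : ℝ); linarith
    have hK : (4 * Real.exp 4) ^ n ≤ Real.exp (7 * n) := by
      rw [mul_comm (7 : ℝ), Real.exp_nat_mul]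
      gcongr
      rw [show (7 : ℝ) = 3 + 4 by norm_num, Real.exp_add]
      gcongr
    have hlogn : Real.log (n + 1) ≤ n := by
      have := Real.log_le_sub_one_of_pos hn1; linarith
    have hdiff : (n : ℝ) ^ 2 * Real.log (n + 1) ≤ n ^ 2 * Real.log n + n := by
      rcases Nat.eq_zero_or_pos n with h0 | h0
      · subst h0; simp
      · have hn0 : (0 : ℝ) < n := by exact_mod_cast h0
        have h := Real.log_le_sub_one_of_pos (show (0 : ℝ) < (n + 1) / n by positivity)
        rw [Real.log_div hn1.ne' hn0.ne'] at h
        have h' : ((n : ℝ) + 1) / n - 1 = 1 / n := by field_simp; ring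
        rw [h'] at h
        have := mul_le_mul_of_nonneg_left h (sq_nonneg (n : ℝ))
        have h'' : (n : ℝ) ^ 2 * (1 / n) = n := by field_simp
        nlinarith
    rw [Finset.prod_range_succ, Nat.factorial_succ]
    push_cast
    calc ((n : ℝ) + 1) * n.factorial * ((∏ k ∈ Finset.range n, ((4 * Real.exp 4) ^ k * Real.exp 4 / (k.factorial : ℝ)))
            * ((4 * Real.exp 4) ^ n * Real.exp 4 / (n.factorial : ℝ)))
        = ((n.factorial : ℝ) * ∏ k ∈ Finset.range n, ((4 * Real.exp 4) ^ k * Real.exp 4 / (k.factorial : ℝ)))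
            * (((n : ℝ) + 1) * ((4 * Real.exp 4) ^ n * Real.exp 4 / (n.factorial : ℝ))) := by ring
      _ ≤ Real.exp (10 * n ^ 2 - (1 / 2) * n ^ 2 * Real.log n) *
            (Real.exp (Real.log (n + 1)) * (Real.exp (7 * n) * Real.exp 4 /
              Real.exp (n * Real.log (n + 1) - n - 1))) := by
          rw [Real.exp_log hn1]
          gcongr
      _ = Real.exp (10 * n ^ 2 - (1 / 2) * n ^ 2 * Real.log n + (Real.log (n + 1) + (7 * n + 4 -
            (n * Real.log (n + 1) - n - 1)))) := by
          rw [Real.exp_add, Real.exp_add, Real.exp_sub (7 * n + 4 : ℝ), Real.exp_add]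
      _ ≤ _ := by
          apply Real.exp_le_exp.mpr
          nlinarith

/-- coefficient class -/
def Cls (s : ℕ) (c : ℕ → ℝ) : Prop :=
  ∀ k, |c k| ≤ (4 * Real.exp 4) ^ s * (4 ^ k / ((k + s).factorial : ℝ))

noncomputable def ev (c : ℕ → ℝ) (y : ℝ) : ℝ := ∑' k, c k * y ^ k

noncomputable def quo (x : ℝ) (c : ℕ → ℝ) : ℕ → ℝ := fun k => ∑' m, c (k + 1 + m) * x ^ m

theorem hasSum_e4 : HasSum (fun m : ℕ => (4 : ℝ) ^ m / (m.factorial : ℝ)) (Real.exp 4) := by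
  have := NormedSpace.expSeries_div_hasSum_exp (4 : ℝ)
  rwa [← Real.exp_eq_exp_ℝ] at this

theorem tail_term {s : ℕ} {c : ℕ → ℝ} (h : Cls s c) {x : ℝ} (hx : |x| ≤ 1) (k m : ℕ) :
    ‖c (k + m) * x ^ m‖ ≤
      (4 * Real.exp 4) ^ s * (4 ^ k / ((k + s).factorial : ℝ)) * (4 ^ m / (m.factorial : ℝ)) := by
  rw [norm_mul, norm_pow, Real.norm_eq_abs, Real.norm_eq_abs]
  have h1 : |x| ^ m ≤ 1 := pow_le_one₀ (abs_nonneg _) hx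
  have hfac : (((k + s).factorial : ℝ)) * (m.factorial : ℝ) ≤ ((k + m + s).factorial : ℝ) := by
    have := Nat.le_of_dvd (Nat.factorial_pos _) (Nat.factorial_mul_factorial_dvd_factorial_add (k + s) m)
    rw [show k + m + s = k + s + m by ring]
    exact_mod_cast this
  calc |c (k + m)| * |x| ^ m ≤ |c (k + m)| * 1 := by gcongr
    _ ≤ (4 * Real.exp 4) ^ s * (4 ^ (k + m) / ((k + m + s).factorial : ℝ)) := by
        rw [mul_one]; exact h _
    _ ≤ (4 * Real.exp 4) ^ s * (4 ^ (k + m) / (((k + s).factorial : ℝ) * (m.factorial : ℝ))) := by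
        gcongr
    _ = _ := by rw [pow_add]; field_simp

theorem tail_summable {s : ℕ} {c : ℕ → ℝ} (h : Cls s c) {x : ℝ} (hx : |x| ≤ 1) (k : ℕ) :
    Summable (fun m => c (k + m) * x ^ m) :=
  Summable.of_norm_bounded (hasSum_e4.summable.mul_left _) (tail_term h hx k)

theorem tail_bound {s : ℕ} {c : ℕ → ℝ} (h : Cls s c) {x : ℝ} (hx : |x| ≤ 1) (k : ℕ) :
    |∑' m, c (k + m) * x ^ m| ≤
      (4 * Real.exp 4) ^ s * (4 ^ k / ((k + s).factorial : ℝ)) * Real.exp 4 :=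
  tsum_of_norm_bounded (hasSum_e4.mul_left _) (tail_term h hx k)

theorem quo_cls {s : ℕ} {c : ℕ → ℝ} (h : Cls s c) {x : ℝ} (hx : |x| ≤ 1) :
    Cls (s + 1) (quo x c) := by
  intro k
  refine (tail_bound h hx (k + 1)).trans (le_of_eq ?_)
  rw [show k + (s + 1) = k + 1 + s by ring]
  ring

theorem ev_bound {s : ℕ} {c : ℕ → ℝ} (h : Cls s c) {x : ℝ} (hx : |x| ≤ 1) :
    |ev c x| ≤ (4 * Real.exp 4) ^ s * Real.exp 4 / (s.factorial : ℝ) := by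
  have := tail_bound h hx 0
  simp only [zero_add, pow_zero] at this
  refine this.trans (le_of_eq ?_)
  ring

theorem ev_succ {s : ℕ} {c : ℕ → ℝ} (h : Cls s c) {y : ℝ} (hy : |y| ≤ 1) :
    ev c y = c 0 + ∑' k, c (k + 1) * y ^ (k + 1) := by
  have hs := tail_summable h hy 0
  simp only [zero_add] at hs
  unfold ev
  rw [hs.tsum_eq_zero_add]
  simp

theorem quo_rec {s : ℕ} {c : ℕ → ℝ} (h : Cls s c) {x : ℝ} (hx : |x| ≤ 1) (k : ℕ) :
    quo x c k = c (k + 1) + x * quo x c (k + 1) := by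
  unfold quo
  rw [(tail_summable h hx (k + 1)).tsum_eq_zero_add, ← tsum_mul_left]
  simp only [add_zero, pow_zero, mul_one]
  congr 1
  apply tsum_congr
  intro m
  rw [show k + 1 + (m + 1) = k + 1 + 1 + m by ring]
  ring

theorem ev_quo {s : ℕ} {c : ℕ → ℝ} (h : Cls s c) {x y : ℝ} (hx : |x| ≤ 1) (hy : |y| ≤ 1) :
    ev c y = ev c x + (y - x) * ev (quo x c) y := by
  have hq := quo_cls h hx
  have e1 := ev_succ hq hy
  have sq := tail_summable hq hy 0
  simp only [zero_add] at sq
  have sq1 : Summable (fun k => quo x c (k + 1) * y ^ (k + 1)) :=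
    (summable_nat_add_iff (f := fun k => quo x c k * y ^ k) 1).mpr sq
  have hx0 : x * quo x c 0 = ∑' k, c (k + 1) * x ^ (k + 1) := by
    unfold quo
    rw [← tsum_mul_left]
    apply tsum_congr
    intro m
    rw [show 0 + 1 + m = m + 1 by ring]
    ring
  have hy1 : ∑' k, c (k + 1) * y ^ (k + 1) = y * ev (quo x c) y
      - x * ∑' k, quo x c (k + 1) * y ^ (k + 1) := by
    unfold ev
    rw [← tsum_mul_left, ← tsum_mul_left, ← (sq.mul_left y).tsum_sub (sq1.mul_left x)]
    apply tsum_congr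
    intro k
    rw [quo_rec h hx k]
    ring
  rw [ev_succ h hy, ev_succ h hx, hy1, ← hx0]
  have : ∑' k, quo x c (k + 1) * y ^ (k + 1) = ev (quo x c) y - quo x c 0 := by linarith
  rw [this]
  ring

/-- iterated quotient -/
noncomputable def itq (c : ℕ → ℝ) (p : ℕ → ℝ) : ℕ → (ℕ → ℝ)
  | 0 => c
  | k + 1 => quo (p k) (itq c p k)

theorem itq_cls {c : ℕ → ℝ} (h : Cls 0 c) {p : ℕ → ℝ} (hp : ∀ i, |p i| ≤ 1) (k : ℕ) :
    Cls k (itq c p k) := by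
  induction k with
  | zero => exact h
  | succ k ih => exact quo_cls ih (hp k)

theorem newton {c : ℕ → ℝ} (h : Cls 0 c) {p : ℕ → ℝ} (hp : ∀ i, |p i| ≤ 1) {y : ℝ} (hy : |y| ≤ 1)
    (m : ℕ) : ev c y = ∑ k ∈ Finset.range m, (∏ l ∈ Finset.range k, (y - p l)) * ev (itq c p k) (p k)
      + (∏ l ∈ Finset.range m, (y - p l)) * ev (itq c p m) y := by
  induction m with
  | zero => simp [itq]
  | succ m ih =>
    rw [ih, Finset.sum_range_succ, Finset.prod_range_succ, ev_quo (itq_cls h hp m) (hp m) hy]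
    simp only [itq]
    ring

noncomputable def sc (k : ℕ) : ℝ :=
  if Even k then (-1) ^ (k / 2) * Real.pi ^ k / ((k + 1).factorial : ℝ) else 0

theorem sc_cls : Cls 0 sc := by
  intro k
  unfold sc
  simp only [pow_zero, one_mul, add_zero]
  split_ifs
  · rw [abs_div, abs_mul, abs_pow, abs_neg, abs_one, one_pow, one_mul, abs_pow,
      abs_of_pos Real.pi_pos, Nat.abs_cast]
    have := Real.pi_le_four
    have := Real.pi_pos
    gcongr
    omega
  · simp only [abs_zero]; positivity

theorem sc_ev (x y : ℝ) : sineKernel x y = ev sc (x - y) := by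
  unfold sineKernel ev
  split_ifs with hxy
  · subst hxy
    rw [tsum_eq_single 0]
    · simp [sc]
    · intro k hk; simp [hk]
  · have hne : x - y ≠ 0 := sub_ne_zero.mpr hxy
    set u := x - y
    have hpi := Real.pi_ne_zero
    have h1 := (Real.hasSum_sin (Real.pi * u)).div_const (Real.pi * u)
    have h2 : HasSum (fun k => sc k * u ^ k) (Real.sin (Real.pi * u) / (Real.pi * u) + 0) := by
      apply HasSum.even_add_odd
      · refine (congrArg (fun f => HasSum f _) (funext fun m => ?_)).mp h1
        symm
        simp only [sc, even_two, Even.mul_right, if_true]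
        rw [Nat.mul_div_cancel_left _ (by norm_num)]
        field_simp
        ring_nf
      · refine (congrArg (fun f => HasSum f _) (funext fun m => ?_)).mp (hasSum_zero (α := ℝ) (β := ℕ))
        simp [sc]
    rw [h2.tsum_eq, add_zero]

theorem main_bound (n : ℕ) (x : Fin n → ℝ) (hx : ∀ i j, |x i - x j| ≤ 1) :
    |(Matrix.of fun i j => sineKernel (x i) (x j)).det| ≤
    (n.factorial : ℝ) * ∏ k ∈ Finset.range n, ((4 * Real.exp 4) ^ k * Real.exp 4 / (k.factorial : ℝ)) := by
  classical
  rcases Nat.eq_zero_or_pos n with h0 | h0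
  · subst h0; simp
  let X : ℕ → ℝ := fun k => if h : k < n then x ⟨k, h⟩ else x ⟨0, h0⟩
  have hX : ∀ i : Fin n, X i = x i := fun i => by simp [X]
  have hXd : ∀ k (j : Fin n), |X k - x j| ≤ 1 := by
    intro k j
    simp only [X]
    split_ifs <;> apply hx
  let b : ℕ → ℝ := fun k => (4 * Real.exp 4) ^ k * Real.exp 4 / (k.factorial : ℝ)
  have hb : ∀ k, 0 < b k := fun k => by simp only [b]; positivity
  let d : ℕ → Fin n → ℝ := fun k j => ev (itq sc (fun l => X l - x j) k) (X k - x j)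
  have hd : ∀ k j, |d k j| ≤ b k := fun k j =>
    ev_bound (itq_cls sc_cls (fun l => hXd l j) k) (hXd k j)
  let N : Matrix (Fin n) (Fin n) ℝ := Matrix.of fun i k => ∏ l ∈ Finset.range k, (x i - X l)
  let E : Matrix (Fin n) (Fin n) ℝ := Matrix.of fun k j => d k j / b k
  let D : Matrix (Fin n) (Fin n) ℝ := Matrix.of fun k j => b k * E k j
  have hM : (Matrix.of fun i j => sineKernel (x i) (x j)) = N * D := by
    ext i j
    rw [Matrix.mul_apply, Matrix.of_apply, sc_ev,
      newton sc_cls (p := fun l => X l - x j) (fun l => hXd l j) (hx i j) n,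
      Finset.prod_eq_zero (Finset.mem_range.mpr i.2) (by simp [hX]), zero_mul, add_zero,
      ← Fin.sum_univ_eq_sum_range (fun k => (∏ l ∈ Finset.range k, (x i - x j - (X l - x j))) *
        ev (itq sc (fun l => X l - x j) k) (X k - x j)) n]
    refine Finset.sum_congr rfl fun k _ => ?_
    simp only [N, D, E, Matrix.of_apply, d]
    rw [mul_div_cancel₀ _ (hb k).ne']
    congr 1
    refine Finset.prod_congr rfl fun l _ => ?_
    ring
  have hN : |N.det| ≤ 1 := by
    rw [Matrix.det_of_lowerTriangular N, Finset.abs_prod]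
    · refine Finset.prod_le_one (fun _ _ => abs_nonneg _) fun i _ => ?_
      simp only [N, Matrix.of_apply]
      rw [Finset.abs_prod]
      refine Finset.prod_le_one (fun _ _ => abs_nonneg _) fun l _ => ?_
      rw [abs_sub_comm]; exact hXd l i
    · intro i k hik
      have hik' : i < k := hik
      simp only [N, Matrix.of_apply]
      exact Finset.prod_eq_zero (Finset.mem_range.mpr hik') (by simp [hX])
  have hE : |E.det| ≤ (n.factorial : ℝ) := by
    have := Matrix.det_le (A := E) (abv := AbsoluteValue.abs) (x := 1) (fun i j => by
      simp only [E, Matrix.of_apply, AbsoluteValue.abs_apply]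
      rw [abs_div, abs_of_pos (hb i), div_le_one (hb i)]
      exact hd i j)
    simpa using this
  have hD : D.det = (∏ k ∈ Finset.range n, b k) * E.det := by
    rw [← Fin.prod_univ_eq_prod_range]
    exact Matrix.det_mul_column (fun k : Fin n => b k) E
  rw [hM, Matrix.det_mul, hD, abs_mul, abs_mul,
    abs_of_pos (Finset.prod_pos fun k _ => hb k)]
  have hP : 0 < ∏ k ∈ Finset.range n, b k := Finset.prod_pos fun k _ => hb k
  calc |N.det| * ((∏ k ∈ Finset.range n, b k) * |E.det|)
      ≤ 1 * ((∏ k ∈ Finset.range n, b k) * n.factorial) := by gcongr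
    _ = _ := by rw [one_mul, mul_comm]

theorem stmt16 :
    ∃ B > 0, ∀ (a : ℝ) (n : ℕ), 1 ≤ n → ∀ x : Fin n → ℝ,
      (∀ i, x i ∈ Set.Icc a (a + 1)) →
      |(Matrix.of fun i j => sineKernel (x i) (x j)).det| ≤
        Real.exp (B * n ^ 2 - (1 / 2) * n ^ 2 * Real.log n) := by
  refine ⟨10, by norm_num, fun a n _ x hx => ?_⟩
  refine (main_bound n x fun i j => ?_).trans (aux_final n)
  have h1 := hx i
  have h2 := hx j
  rw [Set.mem_Icc] at h1 h2
  rw [abs_le]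
  constructor <;> linarith [h1.1, h1.2, h2.1, h2.2]
end
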